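/- Let n1, n2, r, s1, s2 be positive integers with r·s1 ≤ n1 and r·s2 ≤ n2, let k1 := r·s1, k2 := r·s2, and let 0 < ε < 1. Let S := {X ∈ M^{n1×n2}_{r,s1,s2} : ‖X‖_F = 1}. Then there exists a finite set R ⊆ S such that for every X ∈ S there is R ∈ R with ‖X − R‖_F ≤ ε, and log|R| ≤ (k1 + k2)·(1 + log max{n1/k1, n2/k2} + r·log(9/ε)). -/

import Mathlib

open MeasureTheory ProbabilityTheory
open scoped BigOperators
noncomputable section

/-- The set `M^{n1×n2}_{r,s1,s2}` of matrices `Σ_{i=1}^r x_i y_iᵀ` with `‖x_i‖₀ ≤ s1` and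
`‖y_i‖₀ ≤ s2`, i.e. simultaneously `(s1,s2)`-sparse matrices of rank at most `r`. -/
def sparseLowRank (n1 n2 r s1 s2 : ℕ) : Set (Matrix (Fin n1) (Fin n2) ℝ) :=
  {X | ∃ x : Fin r → Fin n1 → ℝ, ∃ y : Fin r → Fin n2 → ℝ,
    (∀ i, {a | x i a ≠ 0}.ncard ≤ s1) ∧ (∀ i, {b | y i b ≠ 0}.ncard ≤ s2) ∧
    X = ∑ i, Matrix.vecMulVec (x i) (y i)}

/-- The Frobenius norm of a matrix. -/
def frobNorm {n1 n2 : ℕ} (X : Matrix (Fin n1) (Fin n2) ℝ) : ℝ :=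
  Real.sqrt (∑ a, ∑ b, (X a b) ^ 2)


lemma net_card_aux {E : Type*} [NormedAddCommGroup E] [NormedSpace ℝ E] [FiniteDimensional ℝ E]
    (δ : ℝ) (hδ : 0 < δ) (N : Finset E) (hN : ∀ p ∈ N, ‖p‖ ≤ 1)
    (hsep : ∀ p ∈ N, ∀ q ∈ N, p ≠ q → δ < ‖p - q‖) :
    (N.card : ℝ) ≤ (1 + 2 / δ) ^ Module.finrank ℝ E := by
  let _ : MeasurableSpace E := borel E
  have _ : BorelSpace E := ⟨rfl⟩
  let μ : Measure E := Measure.addHaar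
  have hd : (N : Set E).PairwiseDisjoint (fun p => Metric.ball p (δ / 2)) := by
    intro p hp q hq hpq
    apply Metric.ball_disjoint_ball
    rw [dist_eq_norm]
    have := hsep p hp q hq hpq
    linarith
  have hsub : (⋃ p ∈ N, Metric.ball p (δ / 2)) ⊆ Metric.ball (0 : E) (1 + δ / 2) := by
    intro z hz
    simp only [Set.mem_iUnion, Metric.mem_ball, dist_eq_norm] at hz
    obtain ⟨p, hp, hz⟩ := hz
    have h1 := hN p hp
    have h2 : ‖z‖ ≤ ‖z - p‖ + ‖p‖ := by simpa using norm_add_le (z - p) p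
    simp only [Metric.mem_ball, dist_zero_right]
    linarith
  have h3 := measure_mono (μ := μ) hsub
  rw [measure_biUnion_finset hd (fun p _ => measurableSet_ball)] at h3
  have hpos : 0 < μ (Metric.ball (0:E) 1) := Metric.measure_ball_pos _ _ one_pos
  have hfin : μ (Metric.ball (0:E) 1) ≠ ⊤ := measure_ball_lt_top.ne
  rw [Measure.addHaar_ball_of_pos μ 0 (show 0 < 1 + δ/2 by positivity)] at h3
  simp_rw [Measure.addHaar_ball_of_pos μ _ (show 0 < δ/2 by positivity)] at h3
  rw [Finset.sum_const, nsmul_eq_mul, ← mul_assoc,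
    ENNReal.mul_le_mul_iff_left hpos.ne' hfin, ← ENNReal.ofReal_natCast,
    ← ENNReal.ofReal_mul (by positivity), ENNReal.ofReal_le_ofReal_iff (by positivity)] at h3
  have h4 : (1 + 2 / δ) = (1 + δ/2) / (δ/2) := by field_simp; ring
  rw [h4, div_pow, le_div_iff₀ (by positivity)]
  exact h3

lemma exists_ball_net {E : Type*} [NormedAddCommGroup E] [NormedSpace ℝ E]
    [FiniteDimensional ℝ E] (δ : ℝ) (hδ : 0 < δ) :
    ∃ N : Finset E, (N.card : ℝ) ≤ (1 + 2 / δ) ^ Module.finrank ℝ E ∧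
      ∀ x : E, ‖x‖ ≤ 1 → ∃ p ∈ N, ‖p‖ ≤ 1 ∧ ‖x - p‖ ≤ δ := by
  classical
  let P : ℕ → Prop := fun m => ∃ N : Finset E, N.card = m ∧ (∀ p ∈ N, ‖p‖ ≤ 1) ∧
    (∀ p ∈ N, ∀ q ∈ N, p ≠ q → δ < ‖p - q‖)
  have hb : ∀ m, P m → m ≤ ⌊(1 + 2 / δ) ^ Module.finrank ℝ E⌋₊ := by
    rintro m ⟨N, rfl, h1, h2⟩
    exact Nat.le_floor (net_card_aux δ hδ N h1 h2)
  have h0 : P 0 := ⟨∅, by simp⟩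
  obtain ⟨N, hc, h1, h2⟩ := Nat.findGreatest_spec (P := P) (Nat.zero_le _) h0
  refine ⟨N, net_card_aux δ hδ N h1 h2, fun x hx => ?_⟩
  by_contra! hcon
  have hcon' : ∀ p ∈ N, δ < ‖x - p‖ := fun p hp => hcon p hp (h1 p hp)
  have hxN : x ∉ N := fun h => by have := hcon' x h; simp at this; linarith
  have hP : P (N.card + 1) := by
    refine ⟨insert x N, Finset.card_insert_of_notMem hxN, ?_, ?_⟩
    · intro p hp
      rcases Finset.mem_insert.1 hp with rfl | hp
      · exact hx
      · exact h1 p hp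
    · intro p hp q hq hpq
      rcases Finset.mem_insert.1 hp with rfl | hp' <;> rcases Finset.mem_insert.1 hq with rfl | hq'
      · exact absurd rfl hpq
      · exact hcon' q hq'
      · rw [norm_sub_rev]; exact hcon' p hp'
      · exact h2 p hp' q hq' hpq
  have := Nat.le_findGreatest (P := P) (m := N.card + 1) (hb (N.card + 1) hP) hP
  rw [← hc] at this
  exact Nat.not_succ_le_self _ this

lemma exists_partial_isometry {E : Type*} [NormedAddCommGroup E] [InnerProductSpace ℝ E]
    [FiniteDimensional ℝ E] {r : ℕ} (x : Fin r → E) :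
    ∃ Q : EuclideanSpace ℝ (Fin r) →L[ℝ] E, ‖Q‖ ≤ 1 ∧
      ∀ v ∈ Submodule.span ℝ (Set.range x), ∃ c, Q c = v ∧ ‖c‖ = ‖v‖ := by
  set W := Submodule.span ℝ (Set.range x) with hW
  have hd : Module.finrank ℝ W ≤ r := by
    have := finrank_range_le_card (R := ℝ) x
    rwa [Fintype.card_fin] at this
  let b := stdOrthonormalBasis ℝ W
  let f : W →ₗ[ℝ] EuclideanSpace ℝ (Fin r) :=
    b.toBasis.constr ℝ (fun i => EuclideanSpace.basisFun (Fin r) ℝ (Fin.castLE hd i))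
  let L : W →ₗᵢ[ℝ] EuclideanSpace ℝ (Fin r) := LinearMap.isometryOfOrthonormal f
    (v := b.toBasis) (by simp) (by
      have : (f ∘ b.toBasis) = (EuclideanSpace.basisFun (Fin r) ℝ) ∘ (Fin.castLE hd) := by
        funext i
        simp only [f, Function.comp, Module.Basis.constr_basis]
      rw [this]
      exact (EuclideanSpace.basisFun (Fin r) ℝ).orthonormal.comp _ (Fin.castLE_injective hd))
  refine ⟨W.subtypeL ∘L (ContinuousLinearMap.adjoint L.toContinuousLinearMap), ?_, ?_⟩
  · refine (ContinuousLinearMap.opNorm_comp_le _ _).trans ?_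
    rw [LinearIsometryEquiv.norm_map]
    exact mul_le_one₀ (Submodule.norm_subtypeL_le W) (norm_nonneg _) L.norm_toContinuousLinearMap_le
  · intro v hv
    refine ⟨L ⟨v, hv⟩, ?_, by simp⟩
    have : (ContinuousLinearMap.adjoint L.toContinuousLinearMap) (L ⟨v, hv⟩) = ⟨v, hv⟩ := by
      apply ext_inner_right ℝ
      intro w
      rw [ContinuousLinearMap.adjoint_inner_left]
      simp [LinearIsometry.inner_map_map]
    simp [this]

lemma choose_le_exp (n k : ℕ) (hk : 0 < k) :
    ((n.choose k : ℕ) : ℝ) ≤ (Real.exp 1 * (n / k)) ^ k := by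
  have h1 : ((n.choose k : ℕ) : ℝ) ≤ (n : ℝ) ^ k / (k.factorial : ℝ) := Nat.choose_le_pow_div k n
  have h2 := Real.pow_div_factorial_le_exp (x := (k:ℝ)) (by positivity) k
  have hk' : (0:ℝ) < k := by exact_mod_cast hk
  refine h1.trans ?_
  rw [mul_pow, ← Real.exp_nat_mul, mul_one, div_pow]
  calc (n : ℝ) ^ k / (k.factorial : ℝ) = ((k:ℝ)^k / k.factorial) * ((n:ℝ)^k / (k:ℝ)^k) := by
        field_simp
    _ ≤ _ := by gcongr


lemma frobNorm_sq_block {n1 n2 : ℕ} (T1 : Finset (Fin n1)) (T2 : Finset (Fin n2))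
    (M : Matrix (Fin n1) (Fin n2) ℝ) (h1 : ∀ a b, a ∉ T1 → M a b = 0)
    (h2 : ∀ a b, b ∉ T2 → M a b = 0)
    (Z : PiLp 2 (fun _ : T2 => EuclideanSpace ℝ T1)) (hZ : ∀ b a, Z b a = M a b) :
    frobNorm M = ‖Z‖ := by
  rw [PiLp.norm_eq_of_L2, frobNorm]
  congr 1
  simp_rw [EuclideanSpace.norm_sq_eq, hZ, Real.norm_eq_abs, sq_abs]
  rw [Finset.sum_comm]
  rw [Finset.sum_coe_sort T2 (fun b => ∑ a : T1, M a b ^ 2)]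
  symm
  rw [Finset.sum_subset (Finset.subset_univ T2)]
  · refine Finset.sum_congr rfl fun b _ => ?_
    rw [Finset.sum_coe_sort T1 (fun a => M a b ^ 2)]
    refine Finset.sum_subset (Finset.subset_univ T1) fun a _ ha => ?_
    simp [h1 a b ha]
  · intro b _ hb
    simp [h2 _ b hb]

/-- Block matrix product, extended by zero. -/
def blockMul {n1 n2 r : ℕ} (T1 : Finset (Fin n1)) (T2 : Finset (Fin n2))
    (Q : EuclideanSpace ℝ (Fin r) →L[ℝ] EuclideanSpace ℝ T1)
    (B : PiLp 2 (fun _ : T2 => EuclideanSpace ℝ (Fin r))) : Matrix (Fin n1) (Fin n2) ℝ :=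
  fun a b => if h : a ∈ T1 ∧ b ∈ T2 then Q (B ⟨b, h.2⟩) ⟨a, h.1⟩ else 0

/-- Apply an operator to each column. -/
def colMap {r : ℕ} {α β : Type*} [Fintype α] [Fintype β]
    (Q : EuclideanSpace ℝ (Fin r) →L[ℝ] EuclideanSpace ℝ α)
    (B : PiLp 2 (fun _ : β => EuclideanSpace ℝ (Fin r))) :
    PiLp 2 (fun _ : β => EuclideanSpace ℝ α) :=
  WithLp.toLp 2 (fun b => Q (B b))

lemma norm_colMap_le {r : ℕ} {α β : Type*} [Fintype α] [Fintype β]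
    (Q : EuclideanSpace ℝ (Fin r) →L[ℝ] EuclideanSpace ℝ α)
    (B : PiLp 2 (fun _ : β => EuclideanSpace ℝ (Fin r))) :
    ‖colMap Q B‖ ≤ ‖Q‖ * ‖B‖ := by
  rw [← abs_of_nonneg (norm_nonneg (colMap Q B)), ← abs_of_nonneg
    (show 0 ≤ ‖Q‖ * ‖B‖ by positivity), ← sq_le_sq, mul_pow, PiLp.norm_sq_eq_of_L2,
    PiLp.norm_sq_eq_of_L2, Finset.mul_sum]
  refine Finset.sum_le_sum fun b _ => ?_
  rw [← mul_pow]
  gcongr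
  exact Q.le_opNorm (B b)

lemma exists_block_net {n1 n2 : ℕ} (r : ℕ) (T1 : Finset (Fin n1)) (T2 : Finset (Fin n2))
    (ε : ℝ) (hε : 0 < ε) (hε1 : ε < 1) :
    ∃ C : Finset (Matrix (Fin n1) (Fin n2) ℝ),
      (C.card : ℝ) ≤ (9 / ε) ^ (r * T1.card + r * T2.card) ∧
      ∀ (x : Fin r → Fin n1 → ℝ) (y : Fin r → Fin n2 → ℝ),
        (∀ i a, a ∉ T1 → x i a = 0) → (∀ i b, b ∉ T2 → y i b = 0) →
        frobNorm (∑ i, Matrix.vecMulVec (x i) (y i)) = 1 →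
        ∃ P ∈ C, frobNorm (∑ i, Matrix.vecMulVec (x i) (y i) - P) ≤ ε / 2 := by
  classical
  obtain ⟨N1, hc1, hN1⟩ := exists_ball_net
    (E := EuclideanSpace ℝ (Fin r) →L[ℝ] EuclideanSpace ℝ T1) (ε / 4) (by positivity)
  obtain ⟨N2, hc2, hN2⟩ := exists_ball_net
    (E := PiLp 2 (fun _ : T2 => EuclideanSpace ℝ (Fin r))) (ε / 4) (by positivity)
  have hf1 : Module.finrank ℝ (EuclideanSpace ℝ (Fin r) →L[ℝ] EuclideanSpace ℝ T1)
      = r * T1.card := by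
    rw [← LinearEquiv.finrank_eq (LinearMap.toContinuousLinearMap
      (E := EuclideanSpace ℝ (Fin r)) (F' := EuclideanSpace ℝ T1) (𝕜 := ℝ)),
      Module.finrank_linearMap]
    simp
  have hf2 : Module.finrank ℝ (PiLp 2 (fun _ : T2 => EuclideanSpace ℝ (Fin r)))
      = r * T2.card := by
    rw [LinearEquiv.finrank_eq (WithLp.linearEquiv 2 ℝ (T2 → EuclideanSpace ℝ (Fin r))),
      Module.finrank_pi_fintype]
    simp [mul_comm]
  have h9 : 1 + 2 / (ε / 4) ≤ 9 / ε := by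
    rw [div_div_eq_mul_div, le_div_iff₀ hε, add_mul, div_mul_cancel₀ _ hε.ne']
    linarith
  have h90 : 0 ≤ 1 + 2 / (ε / 4) := by positivity
  rw [hf1] at hc1
  rw [hf2] at hc2
  refine ⟨(N1 ×ˢ N2).image (fun p => blockMul T1 T2 p.1 p.2), ?_, ?_⟩
  · calc _ ≤ (((N1 ×ˢ N2).card : ℕ) : ℝ) := by exact_mod_cast Finset.card_image_le
      _ = (N1.card : ℝ) * N2.card := by rw [Finset.card_product]; push_cast; rfl
      _ ≤ (9 / ε) ^ (r * T1.card) * (9 / ε) ^ (r * T2.card) := by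
        refine mul_le_mul (hc1.trans (pow_le_pow_left₀ h90 h9 _))
          (hc2.trans (pow_le_pow_left₀ h90 h9 _)) (by positivity) (by positivity)
      _ = _ := by rw [pow_add]
  · intro x y hx hy hX
    set X := ∑ i, Matrix.vecMulVec (x i) (y i) with hXdef
    have hXab : ∀ a b, X a b = ∑ i, x i a * y i b := by
      intro a b
      simp [hXdef, Matrix.sum_apply, Matrix.vecMulVec_apply]
    have hX1 : ∀ a b, a ∉ T1 → X a b = 0 := by
      intro a b ha
      rw [hXab]
      exact Finset.sum_eq_zero fun i _ => by rw [hx i a ha, zero_mul]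
    have hX2 : ∀ a b, b ∉ T2 → X a b = 0 := by
      intro a b hb
      rw [hXab]
      exact Finset.sum_eq_zero fun i _ => by rw [hy i b hb, mul_zero]
    let xr : Fin r → EuclideanSpace ℝ T1 := fun i => WithLp.toLp 2 (fun a => x i a)
    let Z : PiLp 2 (fun _ : T2 => EuclideanSpace ℝ T1) :=
      WithLp.toLp 2 (fun b => ∑ i, y i b • xr i)
    have hZ : ∀ b a, Z b a = X a b := by
      intro b a
      simp [Z, xr, hXab, mul_comm]
    have hZn : ‖Z‖ = 1 := by rw [← frobNorm_sq_block T1 T2 X hX1 hX2 Z hZ, hX]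
    obtain ⟨Q, hQ, hQv⟩ := exists_partial_isometry xr
    have hmem : ∀ b, Z b ∈ Submodule.span ℝ (Set.range xr) := by
      intro b
      change ∑ i, y i b • xr i ∈ _
      exact Submodule.sum_mem _ fun i _ =>
        Submodule.smul_mem _ _ (Submodule.subset_span (Set.mem_range_self i))
    choose c hc hcn using fun b => hQv (Z b) (hmem b)
    let B : PiLp 2 (fun _ : T2 => EuclideanSpace ℝ (Fin r)) := WithLp.toLp 2 c
    have hB : ‖B‖ = 1 := by
      rw [← hZn, PiLp.norm_eq_of_L2, PiLp.norm_eq_of_L2]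
      simp [B, hcn]
    obtain ⟨Q', hQ'N, hQ'1, hQ'⟩ := hN1 Q hQ
    obtain ⟨B', hB'N, hB'1, hB'⟩ := hN2 B hB.le
    refine ⟨blockMul T1 T2 Q' B', Finset.mem_image.2 ⟨(Q', B'), by simp [hQ'N, hB'N], rfl⟩, ?_⟩
    rw [frobNorm_sq_block T1 T2 (X - blockMul T1 T2 Q' B') ?_ ?_
      (colMap (Q - Q') B + colMap Q' (B - B')) ?_]
    · calc _ ≤ ‖colMap (Q - Q') B‖ + ‖colMap Q' (B - B')‖ := norm_add_le _ _
        _ ≤ ‖Q - Q'‖ * ‖B‖ + ‖Q'‖ * ‖B - B'‖ := add_le_add (norm_colMap_le _ _) (norm_colMap_le _ _)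
        _ ≤ ε / 4 * 1 + 1 * (ε / 4) := by rw [hB]; gcongr
        _ = ε / 2 := by ring
    · intro a b ha
      simp [hX1 a b ha, blockMul, ha]
    · intro a b hb
      simp [hX2 a b hb, blockMul, hb]
    · intro b a
      have : Q (B b) = Z b := hc b
      simp [colMap, blockMul, this, hZ]

lemma exists_support {n r s : ℕ} (h : r * s ≤ n) (x : Fin r → Fin n → ℝ)
    (hx : ∀ i, {a | x i a ≠ 0}.ncard ≤ s) :
    ∃ T : Finset (Fin n), T.card = r * s ∧ ∀ i a, a ∉ T → x i a = 0 := by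
  classical
  let U : Finset (Fin n) := Finset.univ.biUnion fun i => Finset.univ.filter fun a => x i a ≠ 0
  have hU : U.card ≤ r * s := by
    refine Finset.card_biUnion_le.trans ?_
    calc _ ≤ ∑ i : Fin r, s := by
          refine Finset.sum_le_sum fun i _ => ?_
          have := hx i
          rwa [Set.ncard_eq_toFinset_card', Set.toFinset_ofPred] at this
      _ = r * s := by simp
  obtain ⟨T, hUT, -, hT⟩ := Finset.exists_subsuperset_card_eq (Finset.subset_univ U) hU (by simpa)
  refine ⟨T, hT, fun i a ha => ?_⟩
  by_contra hne
  exact ha (hUT (by simp only [U, Finset.mem_biUnion, Finset.mem_filter, Finset.mem_univ, true_and]; exact ⟨i, hne⟩))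

lemma frobNorm_eq {n1 n2 : ℕ} (X : Matrix (Fin n1) (Fin n2) ℝ) :
    frobNorm X = ‖(WithLp.toLp 2 (fun p : Fin n1 × Fin n2 => X p.1 p.2) :
      EuclideanSpace ℝ (Fin n1 × Fin n2))‖ := by
  rw [EuclideanSpace.norm_eq, frobNorm, Fintype.sum_prod_type]
  simp

lemma frobNorm_tri {n1 n2 : ℕ} (X P Y : Matrix (Fin n1) (Fin n2) ℝ) :
    frobNorm (X - Y) ≤ frobNorm (X - P) + frobNorm (Y - P) := by
  simp only [frobNorm_eq]
  refine le_trans (le_of_eq ?_) (norm_sub_le _ _)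
  congr 1
  ext p
  simp

/-- An `ε`-net `R ⊆ S` for the unit Frobenius sphere `S` of
`M^{n1×n2}_{r,s1,s2}` with `log |R| ≤ (k1+k2)(1 + log max{n1/k1, n2/k2} + r log(9/ε))`,
where `k1 = r s1`, `k2 = r s2`. -/
theorem exists_epsNet_sparseLowRank (n1 n2 r s1 s2 : ℕ)
    (hr : 0 < r) (hs1 : 0 < s1) (hs2 : 0 < s2) (hn1 : 0 < n1) (hn2 : 0 < n2)
    (h1 : r * s1 ≤ n1) (h2 : r * s2 ≤ n2)
    (ε : ℝ) (hε : 0 < ε) (hε1 : ε < 1) :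
    ∃ R : Finset (Matrix (Fin n1) (Fin n2) ℝ),
      ↑R ⊆ {X ∈ sparseLowRank n1 n2 r s1 s2 | frobNorm X = 1} ∧
      (∀ X ∈ {X ∈ sparseLowRank n1 n2 r s1 s2 | frobNorm X = 1},
        ∃ Y ∈ R, frobNorm (X - Y) ≤ ε) ∧
      Real.log R.card ≤
        ((r * s1 + r * s2 : ℕ) : ℝ) *
          (1 + Real.log (max ((n1 : ℝ) / (r * s1)) ((n2 : ℝ) / (r * s2))) +
            r * Real.log (9 / ε)) := by
  classical
  set S := {X ∈ sparseLowRank n1 n2 r s1 s2 | frobNorm X = 1} with hS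
  have hk1 : 0 < r * s1 := Nat.mul_pos hr hs1
  have hk2 : 0 < r * s2 := Nat.mul_pos hr hs2
  choose C hCc hC using fun (T1 : Finset (Fin n1)) (T2 : Finset (Fin n2)) =>
    exists_block_net r T1 T2 ε hε hε1
  let A1 := (Finset.univ : Finset (Fin n1)).powersetCard (r * s1)
  let A2 := (Finset.univ : Finset (Fin n2)).powersetCard (r * s2)
  let D : Finset (Matrix (Fin n1) (Fin n2) ℝ) := (A1 ×ˢ A2).biUnion fun p => C p.1 p.2
  let D' := D.filter fun P => ∃ Y ∈ S, frobNorm (Y - P) ≤ ε / 2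
  let g : Matrix (Fin n1) (Fin n2) ℝ → Matrix (Fin n1) (Fin n2) ℝ := fun P =>
    if h : ∃ Y ∈ S, frobNorm (Y - P) ≤ ε / 2 then h.choose else 0
  have hg : ∀ P, (∃ Y ∈ S, frobNorm (Y - P) ≤ ε / 2) →
      g P ∈ S ∧ frobNorm (g P - P) ≤ ε / 2 := by
    intro P h
    simp only [g, dif_pos h]
    exact h.choose_spec
  have hm1 : 1 ≤ (n1 : ℝ) / (r * s1) := by
    rw [le_div_iff₀ (by exact_mod_cast hk1), one_mul]; exact_mod_cast h1
  set m := max ((n1 : ℝ) / (r * s1)) ((n2 : ℝ) / (r * s2)) with hm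
  have hm0 : 1 ≤ m := hm1.trans (le_max_left _ _)
  have h9 : 1 ≤ 9 / ε := by rw [le_div_iff₀ hε]; linarith
  have hcard : ((D'.image g).card : ℝ) ≤
      (Real.exp 1 * m) ^ (r * s1 + r * s2) * (9 / ε) ^ (r * (r * s1) + r * (r * s2)) := by
    have hD : ((D'.image g).card : ℝ) ≤ D.card := by
      exact_mod_cast Finset.card_image_le.trans (Finset.card_filter_le _ _)
    have hD2 : (D.card : ℝ) ≤ ∑ p ∈ A1 ×ˢ A2, ((C p.1 p.2).card : ℝ) := by
      exact_mod_cast Finset.card_biUnion_le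
    have hD3 : ∑ p ∈ A1 ×ˢ A2, ((C p.1 p.2).card : ℝ) ≤
        ∑ p ∈ A1 ×ˢ A2, (9 / ε) ^ (r * (r * s1) + r * (r * s2)) := by
      refine Finset.sum_le_sum fun p hp => ?_
      obtain ⟨hp1, hp2⟩ := Finset.mem_product.1 hp
      have e1 := (Finset.mem_powersetCard.1 hp1).2
      have e2 := (Finset.mem_powersetCard.1 hp2).2
      have := hCc p.1 p.2
      rwa [e1, e2] at this
    refine hD.trans (hD2.trans (hD3.trans ?_))
    rw [Finset.sum_const, nsmul_eq_mul, Finset.card_product, Finset.card_powersetCard,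
      Finset.card_powersetCard, Finset.card_fin, Finset.card_fin]
    refine mul_le_mul_of_nonneg_right ?_ (by positivity)
    rw [pow_add, Nat.cast_mul]
    refine mul_le_mul ((choose_le_exp n1 _ hk1).trans ?_) ((choose_le_exp n2 _ hk2).trans ?_)
      (by positivity) (by positivity)
    · have : (n1 : ℝ) / ((r * s1 : ℕ) : ℝ) ≤ m := by push_cast; exact le_max_left _ _
      gcongr
    · have : (n2 : ℝ) / ((r * s2 : ℕ) : ℝ) ≤ m := by push_cast; exact le_max_right _ _
      gcongr
  refine ⟨D'.image g, ?_, ?_, ?_⟩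
  · intro Y hY
    obtain ⟨P, hP, rfl⟩ := Finset.mem_image.1 (Finset.mem_coe.1 hY)
    exact (hg P (Finset.mem_filter.1 hP).2).1
  · intro X hXS
    obtain ⟨⟨x, y, hx, hy, hXe⟩, hX1⟩ := id hXS
    obtain ⟨T1, hT1, hxT⟩ := exists_support h1 x hx
    obtain ⟨T2, hT2, hyT⟩ := exists_support h2 y hy
    obtain ⟨P, hPC, hP⟩ := hC T1 T2 x y hxT hyT (by rw [← hXe]; exact hX1)
    rw [← hXe] at hP
    have hex : ∃ Y ∈ S, frobNorm (Y - P) ≤ ε / 2 := ⟨X, hXS, hP⟩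
    refine ⟨g P, Finset.mem_image.2 ⟨P, Finset.mem_filter.2 ⟨?_, hex⟩, rfl⟩, ?_⟩
    · exact Finset.mem_biUnion.2 ⟨(T1, T2), Finset.mem_product.2
        ⟨Finset.mem_powersetCard.2 ⟨Finset.subset_univ _, hT1⟩,
          Finset.mem_powersetCard.2 ⟨Finset.subset_univ _, hT2⟩⟩, hPC⟩
    · have := frobNorm_tri X P (g P)
      have := (hg P hex).2
      linarith
  · have hrhs : Real.log ((Real.exp 1 * m) ^ (r * s1 + r * s2) *
        (9 / ε) ^ (r * (r * s1) + r * (r * s2))) = ((r * s1 + r * s2 : ℕ) : ℝ) *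
          (1 + Real.log m + r * Real.log (9 / ε)) := by
      have hmp : 0 < m := by linarith
      rw [Real.log_mul (by positivity) (by positivity), Real.log_pow, Real.log_pow,
        Real.log_mul (by positivity) (by positivity), Real.log_exp]
      push_cast
      ring
    rw [← hrhs]
    rcases Nat.eq_zero_or_pos (D'.image g).card with h0 | h0
    · rw [h0, hrhs]
      have := Real.log_nonneg hm0
      have := Real.log_nonneg h9
      simp only [Nat.cast_zero, Real.log_zero]
      positivity
    · exact Real.log_le_log (by exact_mod_cast h0) hcard
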